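/- Let n be a squarefree positive integer. Then n is a congruent number (i.e., there exist positive rational numbers a, b, c with a² + b² = c² and (1/2)·a·b = n) if and only if the elliptic curve Eₙ : y² = x³ − n²x has positive rank over ℚ, equivalently, if and only if the set of rational points (x, y) ∈ ℚ × ℚ satisfying y² = x³ − n²x is infinite. -/

import Mathlib

lemma zmod_aux : ∀ d s t n : ZMod (2 ^ 2), s ^ 2 = d ^ 2 + n → t ^ 2 = d ^ 2 - n → n = 0 := by
  decide

lemma norm_le_of_sq {s : ℚ_[2]} (h : ‖s ^ 2‖ ≤ 1) : ‖s‖ ≤ 1 := by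
  rw [norm_pow] at h
  exact (pow_le_one_iff_of_nonneg (norm_nonneg s) two_ne_zero).1 h

lemma norm_nat_le (n : ℕ) : ‖(n : ℚ_[2])‖ ≤ 1 := by
  exact_mod_cast Padic.norm_int_le_one (p := 2) (n : ℤ)

lemma one_le_norm (n : ℕ) (hsf : Squarefree n) (a b c : ℚ_[2])
    (h1 : a ^ 2 + b ^ 2 = c ^ 2) (h2 : a * b = 2 * n) : 1 ≤ ‖c‖ := by
  by_contra hc
  push Not at hc
  have hc' : ‖c‖ ≤ 2⁻¹ := by
    have := (Padic.norm_le_pow_iff_norm_lt_pow_add_one c (-1)).2 (by simpa using hc)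
    simpa using this
  have h2n : ‖(2 : ℚ_[2])‖ = 2⁻¹ := by simpa using Padic.norm_p (p := 2)
  have hn := norm_nat_le n
  have hd : ‖c / 2‖ ≤ 1 := by
    rw [norm_div, h2n, div_le_one (by norm_num)]; exact hc'
  have hd2 : ‖(c / 2) ^ 2‖ ≤ 1 := by
    rw [norm_pow]; exact pow_le_one₀ (norm_nonneg _) hd
  have es : ((a + b) / 2) ^ 2 = (c / 2) ^ 2 + n := by
    linear_combination h1 / 4 + h2 / 2
  have et : ((a - b) / 2) ^ 2 = (c / 2) ^ 2 - n := by
    linear_combination h1 / 4 - h2 / 2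
  have hs : ‖(a + b) / 2‖ ≤ 1 := norm_le_of_sq (by
    rw [es]; exact (Padic.nonarchimedean _ _).trans (max_le hd2 hn))
  have ht : ‖(a - b) / 2‖ ≤ 1 := norm_le_of_sq (by
    rw [et, sub_eq_add_neg]
    exact (Padic.nonarchimedean _ _).trans (max_le hd2 (by rwa [norm_neg])))
  let d : ℤ_[2] := ⟨c / 2, hd⟩
  let s : ℤ_[2] := ⟨(a + b) / 2, hs⟩
  let t : ℤ_[2] := ⟨(a - b) / 2, ht⟩
  have es' : s ^ 2 = d ^ 2 + n := by
    apply Subtype.ext; push_cast; exact es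
  have et' : t ^ 2 = d ^ 2 - n := by
    apply Subtype.ext; push_cast; exact et
  have es2 := congrArg (PadicInt.toZModPow (p := 2) 2) es'
  have et2 := congrArg (PadicInt.toZModPow (p := 2) 2) et'
  rw [map_pow, map_add, map_pow, map_natCast] at es2
  rw [map_pow, map_sub, map_pow, map_natCast] at et2
  have h0 := zmod_aux _ _ _ _ es2 et2
  rw [ZMod.natCast_eq_zero_iff] at h0
  have := hsf 2 (by simpa [pow_two] using h0)
  simp at this

lemma step_norm (n : ℕ) (hsf : Squarefree n) (a b c : ℚ_[2])
    (h1 : a ^ 2 + b ^ 2 = c ^ 2) (h2 : a * b = 2 * n) :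
    ‖a ^ 2 - b ^ 2‖ = ‖c‖ ^ 2 ∧ ‖c ^ 4 + 16 * n ^ 2‖ = ‖c‖ ^ 4 := by
  have hc := one_le_norm n hsf a b c h1 h2
  have h2n : ‖(2 : ℚ_[2])‖ = 2⁻¹ := by simpa using Padic.norm_p (p := 2)
  have hn := norm_nat_le n
  have h16 : ‖(16 * n ^ 2 : ℚ_[2])‖ < 1 := by
    rw [show (16 : ℚ_[2]) = 2 ^ 4 by norm_num, norm_mul, norm_pow, norm_pow, h2n]
    have := pow_le_one₀ (n := 2) (norm_nonneg _) hn
    linarith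
  have hc4 : 1 ≤ ‖c ^ 4‖ := by rw [norm_pow]; exact one_le_pow₀ hc
  have hlt := h16.trans_le hc4
  constructor
  · have e : (a ^ 2 - b ^ 2) ^ 2 = c ^ 4 + -(16 * n ^ 2) := by
      linear_combination (a ^ 2 + b ^ 2 + c ^ 2) * h1 - 4 * (a * b + 2 * n) * h2
    have : ‖(a ^ 2 - b ^ 2) ^ 2‖ = ‖c‖ ^ 4 := by
      rw [e, Padic.add_eq_max_of_ne (by rw [norm_neg]; exact hlt.ne'), norm_neg,
        max_eq_left hlt.le, norm_pow]
    rw [norm_pow] at this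
    exact (pow_left_inj₀ (norm_nonneg _) (by positivity) two_ne_zero).1 (this.trans (by ring))
  · rw [Padic.add_eq_max_of_ne hlt.ne', max_eq_left hlt.le, norm_pow]

theorem congruent_iff_infinite_points (n : ℕ) (hn : 0 < n) (hsf : Squarefree n) :
    (∃ a b c : ℚ, 0 < a ∧ 0 < b ∧ 0 < c ∧ a ^ 2 + b ^ 2 = c ^ 2 ∧ a * b / 2 = n) ↔
    {p : ℚ × ℚ | p.2 ^ 2 = p.1 ^ 3 - (n : ℚ) ^ 2 * p.1}.Infinite := by
  have hnq : (0 : ℚ) < n := by exact_mod_cast hn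
  constructor
  · rintro ⟨a, b, c, -, -, -, h1, h2⟩ hfin
    let T : Set (ℚ × ℚ) := {p | p.2 ^ 2 = p.1 ^ 3 - (n : ℚ) ^ 2 * p.1 ∧
      ∃ a b c : ℚ, a ^ 2 + b ^ 2 = c ^ 2 ∧ a * b = 2 * n ∧ p.1 = c ^ 2 / 4}
    have hT : T.Finite := hfin.subset fun p hp => hp.1
    have key : ∀ a b c : ℚ, a ^ 2 + b ^ 2 = c ^ 2 → a * b = 2 * n →
        (c ^ 2 / 4, c * (a ^ 2 - b ^ 2) / 8) ∈ T := by
      intro a b c h1 h2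
      refine ⟨?_, a, b, c, h1, h2, rfl⟩
      have e : (a ^ 2 - b ^ 2) ^ 2 = c ^ 4 - (16 * n ^ 2) := by
        linear_combination (a ^ 2 + b ^ 2 + c ^ 2) * h1 - 4 * (a * b + 2 * n) * h2
      show (c * (a ^ 2 - b ^ 2) / 8) ^ 2 = (c ^ 2 / 4) ^ 3 - (n : ℚ) ^ 2 * (c ^ 2 / 4)
      linear_combination c ^ 2 / 64 * e
    obtain ⟨p, ⟨-, a, b, c, h1, h2, hp⟩, hmax⟩ := Set.exists_max_image T
      (fun p => ‖(p.1 : ℚ_[2])‖) hT ⟨_, key a b c h1 (by linarith)⟩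
    have h1' : (a : ℚ_[2]) ^ 2 + (b : ℚ_[2]) ^ 2 = (c : ℚ_[2]) ^ 2 := by exact_mod_cast h1
    have h2' : (a : ℚ_[2]) * (b : ℚ_[2]) = 2 * n := by exact_mod_cast h2
    have hc := one_le_norm n hsf _ _ _ h1' h2'
    obtain ⟨s1, s2⟩ := step_norm n hsf _ _ _ h1' h2'
    have hc0 : c ≠ 0 := by
      rintro rfl
      simp at hc
      linarith
    have hab : a ^ 2 - b ^ 2 ≠ 0 := by
      intro h
      have h' : (a : ℚ_[2]) ^ 2 - (b : ℚ_[2]) ^ 2 = 0 := by exact_mod_cast h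
      rw [h', norm_zero] at s1
      nlinarith
    have e : (a ^ 2 - b ^ 2) ^ 2 = c ^ 4 - (16 * n ^ 2) := by
      linear_combination (a ^ 2 + b ^ 2 + c ^ 2) * h1 - 4 * (a * b + 2 * n) * h2
    have := hmax _ (key ((a ^ 2 - b ^ 2) / (2 * c)) (4 * n * c / (a ^ 2 - b ^ 2))
      ((c ^ 4 + 16 * n ^ 2) / (2 * c * (a ^ 2 - b ^ 2))) (by
        generalize a ^ 2 - b ^ 2 = u at *
        field_simp
        linear_combination (u ^ 2 + c ^ 4 - 16 * n ^ 2) * e) (by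
        generalize a ^ 2 - b ^ 2 = u at *
        field_simp
        ring))
    have h2n : ‖(2 : ℚ_[2])‖ = 2⁻¹ := by simpa using Padic.norm_p (p := 2)
    simp only [hp] at this
    push_cast at this
    rw [norm_div, norm_div, div_le_div_iff_of_pos_right (by simp), norm_pow, norm_pow, norm_div,
      norm_mul, norm_mul, s1, s2, h2n] at this
    have e2 : ‖(c : ℚ_[2])‖ ^ 4 / (2⁻¹ * ‖(c : ℚ_[2])‖ * ‖(c : ℚ_[2])‖ ^ 2) = 2 * ‖(c : ℚ_[2])‖ := by
      have : ‖(c : ℚ_[2])‖ ≠ 0 := by linarith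
      field_simp
    rw [e2] at this
    nlinarith
  · intro hinf
    obtain ⟨⟨x, y⟩, hxy, hne⟩ := hinf.exists_notMem_finset {(0, 0), ((n : ℚ), 0), (-(n : ℚ), 0)}
    simp only [Set.mem_ofPred_eq] at hxy
    have hy : y ≠ 0 := by
      rintro rfl
      apply hne
      have : x * ((x - n) * (x + n)) = 0 := by linear_combination -hxy
      rcases mul_eq_zero.1 this with h | h
      · simp [h]
      rcases mul_eq_zero.1 h with h | h
      · simp [sub_eq_zero.1 h]
      · simp [eq_neg_of_add_eq_zero_left h]
    have hprod : x * (x ^ 2 - n ^ 2) = y ^ 2 := by linear_combination -hxy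
    have hy2 : 0 < y ^ 2 := by positivity
    have hx : x ≠ 0 := by
      rintro rfl
      simp at hprod
      exact hy2.ne hprod
    have hxn : x ^ 2 - n ^ 2 ≠ 0 := by
      intro h
      rw [h] at hprod
      simp at hprod
      exact hy2.ne hprod
    refine ⟨|(x ^ 2 - n ^ 2) / y|, |2 * n * x / y|, |(x ^ 2 + n ^ 2) / y|, ?_, ?_, ?_, ?_, ?_⟩
    · positivity
    · positivity
    · positivity
    · rw [sq_abs, sq_abs, sq_abs]
      field_simp
      ring
    · rw [← abs_mul]
      have : (x ^ 2 - n ^ 2) / y * (2 * n * x / y) = 2 * n := by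
        field_simp
        linear_combination hprod
      rw [this, abs_of_pos (by positivity)]
      ring
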